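/- Let Γ be a tail-triangle C-group of rank n+1 and let 0 ≤ j < k < l ≤ n, where for rank n the subgroup Γ_n is one fixed choice among Γ_n^P, Γ_n^Q (only the index l can equal n). If μ, ν, ξ ∈ Γ satisfy Γ_jμ ∩ Γ_kν ≠ ∅ and Γ_kν ∩ Γ_lξ ≠ ∅, then Γ_jμ ∩ Γ_lξ ≠ ∅. Consequently the relation on ranked cosets defined by 'Γ_jμ < Γ_kν iff j < k and Γ_jμ ∩ Γ_kν ≠ ∅' is transitive, so it makes the set of all such cosets a ranked partially ordered set. -/

import Mathlib

/-!
Tail-triangle C-groups (Monson–Schulte, "Semiregular Polytopes and Amalgamated C-groups").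

A tail-triangle group of rank `n+1` (`n ≥ 2`) is a group `G` generated by involutions
`α 0, …, α (n-1), β` (where `β` plays the role of `β_{n-1}`), with the commutation
relations of the tail-triangle diagram, and it is a tail-triangle C-group if it moreover
satisfies the intersection condition on its distinguished generating family.
The generating family is indexed by `Set.Iic n ⊆ ℕ`, with index `i < n` corresponding
to `α i` and index `n` corresponding to `β`.
-/

namespace TailTriangle

variable {G : Type*} [Group G]

/-- The combined generating family: index `i < n` gives `α i`, index `n` (or beyond) gives `β`. -/
def ttGens (n : ℕ) (α : ℕ → G) (β : G) : ℕ → G := fun i => if i < n then α i else β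

/-- The intersection condition on the generating family, for subsets of the index set `Iic n`. -/
def ttInterCond (n : ℕ) (α : ℕ → G) (β : G) : Prop :=
  ∀ I J : Set ℕ, I ⊆ Set.Iic n → J ⊆ Set.Iic n →
    Subgroup.closure (ttGens n α β '' I) ⊓ Subgroup.closure (ttGens n α β '' J)
      = Subgroup.closure (ttGens n α β '' (I ∩ J))

/-- A tail-triangle group of rank `n+1`. -/
structure IsTailTriangleGroup (n : ℕ) (α : ℕ → G) (β : G) : Prop where
  two_le : 2 ≤ n
  orderOf_α : ∀ i < n, orderOf (α i) = 2
  orderOf_β : orderOf β = 2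
  comm_αα : ∀ i j : ℕ, i + 2 ≤ j → j < n → Commute (α i) (α j)
  comm_αβ : ∀ i : ℕ, i + 3 ≤ n → Commute (α i) β
  closure_eq_top : Subgroup.closure (ttGens n α β '' Set.Iic n) = ⊤

/-- A tail-triangle C-group: a tail-triangle group satisfying the intersection condition. -/
def IsTailTriangleCGroup (n : ℕ) (α : ℕ → G) (β : G) : Prop :=
  IsTailTriangleGroup n α β ∧ ttInterCond n α β

/-- The distinguished subgroup `Γ_j` of rank `j`, for `0 ≤ j ≤ n-1`:
for `j ≤ n-2` it is generated by all generators except `α j`;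
`Γ_{n-1}` is generated by `α 0, …, α (n-2)`. -/
def ttΓ (n : ℕ) (α : ℕ → G) (β : G) (j : ℕ) : Subgroup G :=
  if j = n - 1 then Subgroup.closure (ttGens n α β '' {i | i < n - 1})
  else Subgroup.closure (ttGens n α β '' {i | i ≤ n ∧ i ≠ j})

/-- `Γ_n^P = ⟨α 0, …, α (n-1)⟩`. -/
def ttΓP (n : ℕ) (α : ℕ → G) (β : G) : Subgroup G :=
  Subgroup.closure (ttGens n α β '' {i | i < n})

/-- `Γ_n^Q = ⟨α 0, …, α (n-2), β⟩`. -/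
def ttΓQ (n : ℕ) (α : ℕ → G) (β : G) : Subgroup G :=
  Subgroup.closure (ttGens n α β '' {i | i ≤ n ∧ i ≠ n - 1})

/-- The rank-`j` subgroup where the Boolean `P` chooses `Γ_n^P` (if `true`) or `Γ_n^Q`
(if `false`) at rank `n`. -/
def ttΓ' (n : ℕ) (α : ℕ → G) (β : G) (P : Bool) (j : ℕ) : Subgroup G :=
  if j = n then (if P then ttΓP n α β else ttΓQ n α β) else ttΓ n α β j

/-- The right coset `H μ = {h * μ : h ∈ H}`. -/
def rcoset (H : Subgroup G) (μ : G) : Set G := (· * μ) '' (H : Set G)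

theorem exists_mul_of_mem_closure_union {S T : Set G} (hST : ∀ s ∈ S, ∀ t ∈ T, Commute s t)
    {g : G} (hg : g ∈ Subgroup.closure (S ∪ T)) :
    ∃ a ∈ Subgroup.closure S, ∃ b ∈ Subgroup.closure T, a * b = g := by
  have hcomm : ∀ a ∈ Subgroup.closure S, ∀ b ∈ Subgroup.closure T, b * a = a * b := by
    have hS : Subgroup.closure S ≤ Subgroup.centralizer (Subgroup.closure T : Set G) := by
      rw [Subgroup.centralizer_closure, Subgroup.closure_le]
      exact fun s hs => Subgroup.mem_centralizer_iff.2 fun t ht => (hST s hs t ht).symm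
    exact fun a ha b hb => Subgroup.mem_centralizer_iff.1 (hS ha) b hb
  induction hg using Subgroup.closure_induction with
  | mem x hx =>
    rcases hx with hx | hx
    · exact ⟨x, Subgroup.subset_closure hx, 1, one_mem _, mul_one x⟩
    · exact ⟨1, one_mem _, x, Subgroup.subset_closure hx, one_mul x⟩
  | one => exact ⟨1, one_mem _, 1, one_mem _, mul_one 1⟩
  | mul x y _ _ hx hy =>
    obtain ⟨a, ha, b, hb, rfl⟩ := hx
    obtain ⟨c, hc, d, hd, rfl⟩ := hy
    refine ⟨a * c, mul_mem ha hc, b * d, mul_mem hb hd, ?_⟩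
    rw [mul_assoc, ← mul_assoc c, ← hcomm c hc b hb]
    simp only [mul_assoc]
  | inv x _ hx =>
    obtain ⟨a, ha, b, hb, rfl⟩ := hx
    refine ⟨a⁻¹, inv_mem ha, b⁻¹, inv_mem hb, ?_⟩
    rw [mul_inv_rev, hcomm a⁻¹ (inv_mem ha) b⁻¹ (inv_mem hb)]

theorem IsTailTriangleGroup.commute_ttGens {n : ℕ} {α : ℕ → G} {β : G}
    (h : IsTailTriangleGroup n α β) {i k m : ℕ} (hk : k + 2 ≤ n) (hi : i < k) (hm : k < m) :
    Commute (ttGens n α β i) (ttGens n α β m) := by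
  unfold ttGens
  rw [if_pos (by omega)]
  split_ifs with hmn
  · exact h.comm_αα i m (by omega) hmn
  · exact h.comm_αβ i (by omega)

theorem mem_rcoset {H : Subgroup G} {μ x : G} : x ∈ rcoset H μ ↔ x * μ⁻¹ ∈ H := by
  simp [rcoset]

theorem closure_lt_le_ttΓ' {n : ℕ} (α : ℕ → G) (β : G) (P : Bool) {k l : ℕ}
    (hkl : k < l) (hl : l ≤ n) :
    Subgroup.closure (ttGens n α β '' {i | i < k}) ≤ ttΓ' n α β P l := by
  unfold ttΓ' ttΓ ttΓP ttΓQ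
  split_ifs <;> refine Subgroup.closure_mono (Set.image_mono fun i hi => ?_) <;>
    simp only [Set.mem_ofPred_eq] at hi ⊢ <;> omega

theorem closure_gt_le_ttΓ' {n : ℕ} (α : ℕ → G) (β : G) (P : Bool) {j k : ℕ}
    (hjk : j < k) (hk : k < n) :
    Subgroup.closure (ttGens n α β '' {i | k < i ∧ i ≤ n}) ≤ ttΓ' n α β P j := by
  unfold ttΓ' ttΓ
  rw [if_neg (by omega), if_neg (by omega)]
  refine Subgroup.closure_mono (Set.image_mono fun i hi => ?_)
  simp only [Set.mem_ofPred_eq] at hi ⊢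
  omega

theorem IsTailTriangleGroup.exists_mul_of_mem_ttΓ' {n : ℕ} {α : ℕ → G} {β : G}
    (h : IsTailTriangleGroup n α β) (P : Bool) {k : ℕ} (hk : k < n) {g : G}
    (hg : g ∈ ttΓ' n α β P k) :
    ∃ a ∈ Subgroup.closure (ttGens n α β '' {i | i < k}),
      ∃ b ∈ Subgroup.closure (ttGens n α β '' {i | k < i ∧ i ≤ n}), a * b = g := by
  unfold ttΓ' ttΓ at hg
  rw [if_neg (by omega)] at hg
  split_ifs at hg with hkn
  · subst hkn
    exact ⟨g, hg, 1, one_mem _, mul_one g⟩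
  · apply exists_mul_of_mem_closure_union
    · rintro _ ⟨i, hi, rfl⟩ _ ⟨m, hm, rfl⟩
      exact h.commute_ttGens (by omega) hi hm.1
    · rw [← Set.image_union]
      refine Subgroup.closure_mono (Set.image_mono fun i hi => ?_) hg
      simp only [Set.mem_ofPred_eq, Set.mem_union] at hi ⊢
      omega

/-- Transitivity of the incidence order on ranked right cosets: if `Γ_j μ` meets `Γ_k ν`
and `Γ_k ν` meets `Γ_l ξ`, with `j < k < l ≤ n` (only rank `l` can be `n`, where a fixed
choice among `Γ_n^P`, `Γ_n^Q` is made via `P`), then `Γ_j μ` meets `Γ_l ξ`.  Hence the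
relation `Γ_j μ < Γ_k ν ↔ j < k ∧ Γ_j μ ∩ Γ_k ν ≠ ∅` makes the ranked cosets a poset. -/
theorem incidence_transitive
    (n : ℕ) (α : ℕ → G) (β : G) (h : IsTailTriangleCGroup n α β) (P : Bool) :
    ∀ j k l : ℕ, j < k → k < l → l ≤ n → ∀ μ ν ξ : G,
      (rcoset (ttΓ' n α β P j) μ ∩ rcoset (ttΓ' n α β P k) ν).Nonempty →
      (rcoset (ttΓ' n α β P k) ν ∩ rcoset (ttΓ' n α β P l) ξ).Nonempty →
      (rcoset (ttΓ' n α β P j) μ ∩ rcoset (ttΓ' n α β P l) ξ).Nonempty := by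
  rintro j k l hjk hkl hl μ ν ξ ⟨x, hxμ, hxν⟩ ⟨y, hyν, hyξ⟩
  rw [mem_rcoset] at hxμ hxν hyν hyξ
  have hyx : y * x⁻¹ ∈ ttΓ' n α β P k := by
    simpa [mul_assoc] using mul_mem hyν (inv_mem hxν)
  have hk : k < n := by omega
  obtain ⟨a, ha, b, hb, hab⟩ := h.1.exists_mul_of_mem_ttΓ' P hk hyx
  have hbx : b * x = a⁻¹ * y := by
    rw [eq_inv_mul_iff_mul_eq, ← mul_assoc, hab, inv_mul_cancel_right]
  refine ⟨b * x, mem_rcoset.2 ?_, mem_rcoset.2 ?_⟩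
  · rw [mul_assoc]
    exact mul_mem (closure_gt_le_ttΓ' α β P hjk hk hb) hxμ
  · rw [hbx, mul_assoc]
    exact mul_mem (inv_mem (closure_lt_le_ttΓ' α β P hkl hl ha)) hyξ
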